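/- Time decay of the Schrödinger group in Lorentz spaces: for n ∈ ℕ and 2 ≤ p < ∞, the solution operator S(t) = e^{itΔ} satisfies ‖S(t)f‖_{L^{p,2}(ℝ^n)} ≲ |t|^{-n(1/2 - 1/p)} ‖f‖_{L^{p',2}(ℝ^n)} for all t ≠ 0, where 1/p + 1/p' = 1. -/

import Mathlib

open MeasureTheory ENNReal Set Filter

noncomputable section

abbrev Rn (n : ℕ) := EuclideanSpace ℝ (Fin n)

/-- Decreasing rearrangement of `f` with respect to `μ`. -/
def rearrangement {α : Type*} [MeasurableSpace α] (μ : Measure α)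
    {E : Type*} [NNNorm E] (f : α → E) (t : ℝ) : ℝ≥0∞ :=
  sInf {l : ℝ≥0∞ | μ {x | l < (‖f x‖₊ : ℝ≥0∞)} ≤ ENNReal.ofReal t}

/-- Lorentz quasinorm `‖f‖_{L^{p,q}}` defined via the decreasing rearrangement. -/
def lorentzNorm {α : Type*} [MeasurableSpace α] {E : Type*} [NNNorm E]
    (μ : Measure α) (p q : ℝ≥0∞) (f : α → E) : ℝ≥0∞ :=
  if q = ∞ then ⨆ t ∈ Ioi (0:ℝ), ENNReal.ofReal (t ^ p.toReal⁻¹) * rearrangement μ f t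
  else (∫⁻ t in Ioi (0:ℝ),
      (ENNReal.ofReal (t ^ p.toReal⁻¹) * rearrangement μ f t) ^ q.toReal
        * ENNReal.ofReal t⁻¹) ^ q.toReal⁻¹

/-- `‖f‖_{L^{p,2}(ℝ^n)}`. -/
def lornorm (n : ℕ) (p : ℝ) (f : Rn n → ℂ) : ℝ≥0∞ :=
  lorentzNorm volume (ENNReal.ofReal p) 2 f

/-- The free Schrödinger propagator `e^{itΔ}` on `ℝ^n`, given by convolution with
`(4πit)^{-n/2} e^{i|x|²/(4t)}`. -/
def schrodinger (n : ℕ) (t : ℝ) (f : Rn n → ℂ) : Rn n → ℂ := fun x =>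
  (4 * (Real.pi : ℂ) * Complex.I * (t : ℂ)) ^ (-(n : ℂ) / 2) *
    ∫ y : Rn n, Complex.exp (Complex.I * ((‖x - y‖ : ℂ)) ^ 2 / (4 * (t : ℂ))) * f y

/-- The Strichartz exponent `γ(p)` with `1/γ(p) = (n/2)(1/2 - 1/p)` (so `γ(2) = ∞`). -/
def gam (n : ℕ) (p : ℝ) : ℝ≥0∞ := (ENNReal.ofReal ((n / 2 : ℝ) * (1/2 - 1/p)))⁻¹

/-- Hölder conjugate of an extended-real exponent. -/
def conjE (p : ℝ≥0∞) : ℝ≥0∞ := (1 - p⁻¹)⁻¹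

/-- Mixed space-time norm `‖f‖_{L^γ(I, X)}` given the map `t ↦ ‖f(t)‖_X`. -/
def timeNorm (γ : ℝ≥0∞) (I : Set ℝ) (N : ℝ → ℝ≥0∞) : ℝ≥0∞ :=
  if γ = ∞ then essSup N (volume.restrict I)
  else (∫⁻ t in I, N t ^ γ.toReal) ^ γ.toReal⁻¹

/-- `2 ≤ p < 2*` where `2* = 2n/(n-2)` for `n ≥ 3` and `2* = ∞` for `n = 1, 2`. -/
def subcrit (n : ℕ) (p : ℝ) : Prop := 2 ≤ p ∧ (3 ≤ n → p < 2 * n / (n - 2))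

/-- Duhamel operator `A_S f (t) = ∫_{t₀}^t e^{i(t-τ)Δ} f(τ) dτ`. -/
def duhamel (n : ℕ) (t₀ : ℝ) (f : ℝ → Rn n → ℂ) (t : ℝ) : Rn n → ℂ :=
  fun x => ∫ τ in t₀..t, schrodinger n (t - τ) (f τ) x

/-- The inhomogeneous nonlinearity `|x|^{-b} |u|^σ u`. -/
def nonlin (n : ℕ) (b σ : ℝ) (u : Rn n → ℂ) : Rn n → ℂ := fun x =>
  Complex.ofReal (‖x‖ ^ (-b)) * (Complex.ofReal (‖u x‖ ^ σ) * u x)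

/-- Laplacian on `ℝ^n` of a complex-valued function. -/
def lap (n : ℕ) (f : Rn n → ℂ) (x : Rn n) : ℂ :=
  ∑ i : Fin n, fderiv ℝ (fun y => fderiv ℝ f y (EuclideanSpace.single i 1)) x
    (EuclideanSpace.single i 1)

/-- `u` solves `i ∂_t u + Δ u = λ |x|^{-b} |u|^σ u` classically away from `x = 0`. -/
def solvesINLS (n : ℕ) (b σ : ℝ) (lam : ℂ) (u : ℝ → Rn n → ℂ) : Prop :=
  ∀ t : ℝ, ∀ x : Rn n, x ≠ 0 →
    Complex.I * deriv (fun s => u s x) t + lap n (u t) x =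
      lam * Complex.ofReal (‖x‖ ^ (-b)) * (Complex.ofReal (‖u t x‖ ^ σ) * u t x)

/-- Peetre K-functional for the couple `(L²(ℝ^n), L^r(ℝ^n))`. -/
def Kfun (n : ℕ) (r : ℝ) (t : ℝ) (f : Rn n → ℂ) : ℝ≥0∞ :=
  ⨅ g : Rn n → ℂ,
    eLpNorm g 2 volume + ENNReal.ofReal t * eLpNorm (f - g) (ENNReal.ofReal r) volume

/-- Real interpolation norm for `(L², L^r)_{θ,2}` by the K-method. -/
def interpNorm (n : ℕ) (r θ : ℝ) (f : Rn n → ℂ) : ℝ≥0∞ :=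
  (∫⁻ t in Ioi (0:ℝ), (ENNReal.ofReal (t ^ (-θ)) * Kfun n r t f) ^ (2:ℝ)
    * ENNReal.ofReal t⁻¹) ^ ((2:ℝ)⁻¹)

/-- `u` is a solution of the Duhamel equation for INLS with data `u₀` on the time set `I`,
belonging to `L^{γ(r)}(I, L^{r,2})`. -/
def IsSolOn (n : ℕ) (b σ r : ℝ) (lam : ℂ) (u₀ : Rn n → ℂ) (I : Set ℝ)
    (u : ℝ → Rn n → ℂ) : Prop :=
  Measurable (fun q : ℝ × Rn n => u q.1 q.2) ∧
  timeNorm (gam n r) I (fun t => lornorm n r (u t)) < ∞ ∧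
  ∀ t ∈ I, ∀ᵐ x : Rn n ∂volume, u t x = schrodinger n t u₀ x -
    Complex.I * lam * duhamel n 0 (fun τ => nonlin n b σ (u τ)) t x

end

open FourierTransform SchwartzMap in
/-- The `L²` Fourier transform of an integrable function in `L²` is its Fourier integral. -/
theorem lp_fourier_ae_eq_fourier {V : Type*} [NormedAddCommGroup V] [InnerProductSpace ℝ V]
    [FiniteDimensional ℝ V] [MeasurableSpace V] [BorelSpace V] {h : V → ℂ}
    (h1 : Integrable h) (h2 : MemLp h 2) :
    (𝓕 (h2.toLp h) : Lp ℂ 2 (volume : Measure V)) =ᵐ[volume] 𝓕 h := by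
  have hcont : Continuous (𝓕 h) := VectorFourier.fourierIntegral_continuous (L := innerₗ V)
    Real.continuous_fourierChar continuous_inner h1
  refine ae_eq_of_integral_contDiff_smul_eq
    ((Lp.memLp _).locallyIntegrable (by norm_num)) hcont.locallyIntegrable ?_
  intro g g_smooth g_cpt
  have hg₁ : HasCompactSupport (Complex.ofRealCLM ∘ g) := g_cpt.comp_left rfl
  have hg₂ : ContDiff ℝ (⊤ : ℕ∞) (Complex.ofRealCLM ∘ g) := by fun_prop
  set φ : 𝓢(V, ℂ) := hg₁.toSchwartzMap hg₂ with hφ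
  have key := congrArg (fun T => T φ) (Lp.fourier_toTemperedDistribution_eq (h2.toLp h))
  simp only [TemperedDistribution.fourier_apply, Lp.toTemperedDistribution_apply] at key
  have e1 : ∀ x, φ x = (g x : ℂ) := fun x => rfl
  calc ∫ x, g x • (𝓕 (h2.toLp h) : Lp ℂ 2 (volume : Measure V)) x
      = ∫ x, φ x • (𝓕 (h2.toLp h) : Lp ℂ 2 (volume : Measure V)) x := by
        simp only [e1, Complex.coe_smul]
    _ = ∫ x, (𝓕 φ) x • (h2.toLp h) x := key.symm
    _ = ∫ x, (𝓕 (φ : V → ℂ)) x • h x := by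
        refine integral_congr_ae ?_
        filter_upwards [h2.coeFn_toLp] with x hx
        rw [hx, SchwartzMap.fourier_coe]
    _ = ∫ x, φ x • (𝓕 h) x := by
        have := VectorFourier.integral_fourierIntegral_smul_eq_flip (f := (φ : V → ℂ)) (g := h)
          (L := innerₗ V) (μ := volume) (ν := volume)
          Real.continuous_fourierChar continuous_inner φ.integrable h1
        simpa using! this
    _ = _ := by simp only [e1, Complex.coe_smul]

open FourierTransform in
/-- Plancherel's identity for the Fourier integral. -/
theorem eLpNorm_fourier_eq {V : Type*} [NormedAddCommGroup V] [InnerProductSpace ℝ V]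
    [FiniteDimensional ℝ V] [MeasurableSpace V] [BorelSpace V] {h : V → ℂ}
    (h1 : Integrable h) (h2 : MemLp h 2) :
    eLpNorm (𝓕 h) 2 volume = eLpNorm h 2 volume := by
  rw [← eLpNorm_congr_ae (lp_fourier_ae_eq_fourier h1 h2), ← eLpNorm_congr_ae h2.coeFn_toLp,
    ← Lp.enorm_def, ← Lp.enorm_def, ← ofReal_norm, ← ofReal_norm, Lp.norm_fourier_eq]

/-- The modulus of the Schrödinger kernel at time `t`. -/
noncomputable def kernelBound (n : ℕ) (t : ℝ) : ℝ := (4 * Real.pi * |t|) ^ (-(n : ℝ) / 2)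

theorem kernelBound_pos (n : ℕ) {t : ℝ} (ht : t ≠ 0) : 0 < kernelBound n t :=
  Real.rpow_pos_of_pos (by positivity) _

theorem norm_kernel_const (n : ℕ) {t : ℝ} (ht : t ≠ 0) :
    ‖(4 * (Real.pi : ℂ) * Complex.I * (t : ℂ)) ^ (-(n : ℂ) / 2)‖ = kernelBound n t := by
  have h0 : (4 * (Real.pi : ℂ) * Complex.I * (t : ℂ)) ≠ 0 := by
    simp [ht, Real.pi_ne_zero]
  have e : (-(n : ℂ) / 2) = ((-(n : ℝ) / 2 : ℝ) : ℂ) := by push_cast; ring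
  rw [e, Complex.norm_cpow_of_ne_zero h0, Complex.ofReal_re, Complex.ofReal_im, kernelBound]
  simp [abs_of_pos Real.pi_pos]

theorem norm_exp_I_mul_div (a : ℝ) (t : ℝ) :
    ‖Complex.exp (Complex.I * (a : ℂ) ^ 2 / (4 * (t : ℂ)))‖ = 1 := by
  have : Complex.I * (a : ℂ) ^ 2 / (4 * (t : ℂ)) = ((a ^ 2 / (4 * t) : ℝ) : ℂ) * Complex.I := by
    push_cast; ring
  rw [this, Complex.norm_exp_ofReal_mul_I]

theorem integrable_schrodinger_integrand_iff {n : ℕ} {t : ℝ} {f : Rn n → ℂ} (x : Rn n) :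
    Integrable (fun y : Rn n =>
      Complex.exp (Complex.I * ((‖x - y‖ : ℂ)) ^ 2 / (4 * (t : ℂ))) * f y) ↔ Integrable f := by
  have key : ∀ (g : Rn n → ℂ) (s : ℝ), Integrable g → Integrable (fun y : Rn n =>
      Complex.exp (Complex.I * ((‖x - y‖ : ℂ)) ^ 2 / (4 * (s : ℂ))) * g y) := by
    intro g s hg
    refine hg.bdd_mul (c := 1) ?_ (Eventually.of_forall fun y => (norm_exp_I_mul_div _ _).le)
    exact Continuous.aestronglyMeasurable (by fun_prop)
  refine ⟨fun h => ?_, key f t⟩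
  refine (key _ (-t) h).congr (Eventually.of_forall fun y => ?_)
  simp only [← mul_assoc, ← Complex.exp_add]
  have : Complex.I * (‖x - y‖ : ℂ) ^ 2 / (4 * ((-t : ℝ) : ℂ)) +
      Complex.I * (‖x - y‖ : ℂ) ^ 2 / (4 * (t : ℂ)) = 0 := by
    push_cast
    rw [mul_neg, div_neg, neg_add_cancel]
  rw [this, Complex.exp_zero, one_mul]

theorem schrodinger_of_not_integrable {n : ℕ} {t : ℝ} {f : Rn n → ℂ} (hf : ¬ Integrable f) :
    schrodinger n t f = 0 := by
  funext x
  rw [schrodinger, integral_undef (mt (integrable_schrodinger_integrand_iff x).1 hf), mul_zero]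
  rfl

theorem schrodinger_add {n : ℕ} {t : ℝ} {f g : Rn n → ℂ} (hf : Integrable f)
    (hg : Integrable g) : schrodinger n t (f + g) = schrodinger n t f + schrodinger n t g := by
  funext x
  simp only [schrodinger, Pi.add_apply, mul_add]
  rw [integral_add ((integrable_schrodinger_integrand_iff x).2 hf)
    ((integrable_schrodinger_integrand_iff x).2 hg), mul_add]

theorem enorm_schrodinger_le {n : ℕ} {t : ℝ} (ht : t ≠ 0) (f : Rn n → ℂ) (x : Rn n) :
    ‖schrodinger n t f x‖ₑ ≤ ENNReal.ofReal (kernelBound n t) * ∫⁻ y, ‖f y‖ₑ := by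
  rw [schrodinger, enorm_mul, ← ofReal_norm, norm_kernel_const n ht]
  gcongr
  refine (enorm_integral_le_lintegral_enorm _).trans (le_of_eq (lintegral_congr fun y => ?_))
  rw [enorm_mul, ← ofReal_norm, norm_exp_I_mul_div, ENNReal.ofReal_one, one_mul]

open FourierTransform in
theorem schrodinger_eq_fourier {n : ℕ} {t : ℝ} (ht : t ≠ 0) (f : Rn n → ℂ) (x : Rn n) :
    schrodinger n t f x = (4 * (Real.pi : ℂ) * Complex.I * (t : ℂ)) ^ (-(n : ℂ) / 2) *
      (Complex.exp (Complex.I * (‖x‖ : ℂ) ^ 2 / (4 * (t : ℂ))) *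
        𝓕 (fun y : Rn n => Complex.exp (Complex.I * (‖y‖ : ℂ) ^ 2 / (4 * (t : ℂ))) * f y)
          ((4 * Real.pi * t)⁻¹ • x)) := by
  rw [schrodinger, Real.fourier_eq',
    ← integral_const_mul (Complex.exp (Complex.I * (‖x‖ : ℂ) ^ 2 / (4 * (t : ℂ))))]
  congr 1
  refine integral_congr_ae (Eventually.of_forall fun y => ?_)
  simp only [smul_eq_mul, ← mul_assoc, ← Complex.exp_add]
  congr 2
  have hsq : (‖x - y‖ : ℂ) ^ 2 = (‖x‖ : ℂ) ^ 2 - 2 * ((inner ℝ y x : ℝ) : ℂ) + (‖y‖ : ℂ) ^ 2 := by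
    have := norm_sub_sq_real x y
    rw [real_inner_comm] at this
    exact_mod_cast this
  rw [hsq, inner_smul_right]
  have : (t : ℂ) ≠ 0 := by exact_mod_cast ht
  have : (Real.pi : ℂ) ≠ 0 := by exact_mod_cast Real.pi_ne_zero
  push_cast
  field_simp
  ring

open FourierTransform in
theorem continuous_schrodinger {n : ℕ} {t : ℝ} (ht : t ≠ 0) {f : Rn n → ℂ}
    (hf : Integrable f) : Continuous (schrodinger n t f) := by
  rw [funext (schrodinger_eq_fourier ht f)]
  have h1 : Integrable
      (fun y : Rn n => Complex.exp (Complex.I * (‖y‖ : ℂ) ^ 2 / (4 * (t : ℂ))) * f y) := by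
    have := (integrable_schrodinger_integrand_iff (t := t) (0 : Rn n)).2 hf
    simpa using this
  have hcont := VectorFourier.fourierIntegral_continuous (L := innerₗ (Rn n))
    Real.continuous_fourierChar continuous_inner h1
  have hcont' : Continuous
    (𝓕 (fun y : Rn n => Complex.exp (Complex.I * (‖y‖ : ℂ) ^ 2 / (4 * (t : ℂ))) * f y)) := hcont
  fun_prop

open FourierTransform in
/-- The Schrödinger propagator preserves the `L²` norm. -/
theorem lintegral_schrodinger_sq {n : ℕ} {t : ℝ} (ht : t ≠ 0) {f : Rn n → ℂ}
    (hf : Integrable f) (h2 : MemLp f 2) :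
    ∫⁻ x, ‖schrodinger n t f x‖ₑ ^ (2 : ℝ) = ∫⁻ x, ‖f x‖ₑ ^ (2 : ℝ) := by
  set h : Rn n → ℂ :=
    fun y => Complex.exp (Complex.I * (‖y‖ : ℂ) ^ 2 / (4 * (t : ℂ))) * f y with hh
  have hnorm : ∀ y, ‖h y‖ₑ = ‖f y‖ₑ := fun y => by
    rw [hh, enorm_mul, ← ofReal_norm, norm_exp_I_mul_div, ENNReal.ofReal_one, one_mul]
  have h1 : Integrable h := by
    have := (integrable_schrodinger_integrand_iff (t := t) (0 : Rn n)).2 hf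
    simpa using this
  have h2' : MemLp h 2 := by
    refine h2.congr_enorm h1.1 (Eventually.of_forall fun y => (hnorm y).symm)
  have hpl : ∫⁻ x, ‖𝓕 h x‖ₑ ^ (2 : ℝ) = ∫⁻ x, ‖h x‖ₑ ^ (2 : ℝ) := by
    have := eLpNorm_fourier_eq h1 h2'
    rw [eLpNorm_eq_lintegral_rpow_enorm_toReal two_ne_zero ofNat_ne_top,
      eLpNorm_eq_lintegral_rpow_enorm_toReal two_ne_zero ofNat_ne_top] at this
    exact ENNReal.rpow_left_injective (by simp) this
  have hr : (4 * Real.pi * t)⁻¹ ≠ 0 := by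
    have := Real.pi_ne_zero
    positivity
  have hscale : ∫⁻ x : Rn n, ‖𝓕 h ((4 * Real.pi * t)⁻¹ • x)‖ₑ ^ (2 : ℝ) =
      ENNReal.ofReal ((4 * Real.pi * |t|) ^ n) * ∫⁻ x, ‖𝓕 h x‖ₑ ^ (2 : ℝ) := by
    rw [← (measurableEmbedding_const_smul₀ hr).lintegral_map
      (fun z : Rn n => ‖𝓕 h z‖ₑ ^ (2 : ℝ)), Measure.map_addHaar_smul volume hr,
      lintegral_smul_measure]
    simp only [finrank_euclideanSpace_fin, inv_pow, inv_inv, abs_mul, abs_pow,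
      abs_of_pos Real.pi_pos, Nat.abs_ofNat, smul_eq_mul]
  calc ∫⁻ x, ‖schrodinger n t f x‖ₑ ^ (2 : ℝ)
      = ∫⁻ x, ENNReal.ofReal (kernelBound n t) ^ (2 : ℝ) *
          ‖𝓕 h ((4 * Real.pi * t)⁻¹ • x)‖ₑ ^ (2 : ℝ) := by
        refine lintegral_congr fun x => ?_
        rw [schrodinger_eq_fourier ht, enorm_mul, enorm_mul, ← ofReal_norm, norm_kernel_const n ht,
          ← ofReal_norm (Complex.exp _), norm_exp_I_mul_div, ENNReal.ofReal_one, one_mul,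
          ENNReal.mul_rpow_of_nonneg _ _ zero_le_two]
    _ = ∫⁻ x, ‖f x‖ₑ ^ (2 : ℝ) := by
        rw [lintegral_const_mul' _ _ (by finiteness), hscale, hpl, ← mul_assoc]
        simp only [hnorm]
        have hp : 0 < 4 * Real.pi * |t| := by positivity
        rw [ENNReal.ofReal_rpow_of_nonneg (kernelBound_pos n ht).le zero_le_two,
          ← ENNReal.ofReal_mul (Real.rpow_nonneg (kernelBound_pos n ht).le _), kernelBound,
          ← Real.rpow_mul hp.le,
          ← Real.rpow_natCast, ← Real.rpow_add hp]
        simp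

section Rearrangement

variable {α : Type*} [MeasurableSpace α] {μ : Measure α} {E : Type*} [NormedAddCommGroup E]

theorem rearrangement_le_of_measure_le {f : α → E} {s : ℝ} {l : ℝ≥0∞}
    (h : μ {x | l < ‖f x‖ₑ} ≤ ENNReal.ofReal s) : rearrangement μ f s ≤ l :=
  sInf_le h

theorem measure_rearrangement_lt_le (f : α → E) (s : ℝ) :
    μ {x | rearrangement μ f s < ‖f x‖ₑ} ≤ ENNReal.ofReal s := by
  rcases eq_or_ne (rearrangement μ f s) ⊤ with h | h
  · simp [h]
  obtain ⟨u, hu, hlt, hlim⟩ := exists_seq_strictAnti_tendsto' (lt_top_iff_ne_top.2 h)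
  have hset : {x | rearrangement μ f s < ‖f x‖ₑ} = ⋃ k, {x | u k < ‖f x‖ₑ} := by
    ext x
    simp only [mem_ofPred_eq, mem_iUnion]
    constructor
    · intro hx
      exact (hlim.eventually (gt_mem_nhds hx)).exists
    · rintro ⟨k, hk⟩
      exact (hlt k).1.trans hk
  have hmono : Monotone fun k => {x | u k < ‖f x‖ₑ} := fun i j hij x hx =>
    (hu.antitone hij).trans_lt hx
  rw [hset, hmono.directed_le.measure_iUnion]
  refine iSup_le fun k => ?_
  obtain ⟨l, hl, hlk⟩ := sInf_lt_iff.1 (hlt k).1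
  exact (measure_mono fun x hx => hlk.trans hx).trans hl

theorem lt_rearrangement_iff {f : α → E} {s : ℝ} {l : ℝ≥0∞} :
    l < rearrangement μ f s ↔ ENNReal.ofReal s < μ {x | l < ‖f x‖ₑ} := by
  refine ⟨fun h => ?_, fun h => ?_⟩
  · exact lt_of_not_ge fun h' => h.not_ge (rearrangement_le_of_measure_le h')
  · refine lt_of_not_ge fun h' => h.not_ge ?_
    exact (measure_mono fun x hx => lt_of_le_of_lt h' hx).trans (measure_rearrangement_lt_le f s)

theorem rearrangement_antitone (f : α → E) : Antitone (rearrangement μ f) := fun s _ hst =>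
  rearrangement_le_of_measure_le
    ((measure_rearrangement_lt_le f s).trans (ENNReal.ofReal_le_ofReal hst))

theorem rearrangement_mono {f g : α → E} (h : ∀ x, ‖f x‖ₑ ≤ ‖g x‖ₑ) (s : ℝ) :
    rearrangement μ f s ≤ rearrangement μ g s :=
  rearrangement_le_of_measure_le
    ((measure_mono fun x hx => lt_of_lt_of_le hx (h x)).trans (measure_rearrangement_lt_le g s))

theorem rearrangement_le_of_enorm_le {f : α → E} {c : ℝ≥0∞} (h : ∀ x, ‖f x‖ₑ ≤ c) (s : ℝ) :
    rearrangement μ f s ≤ c :=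
  rearrangement_le_of_measure_le (by simp [fun x => (h x).not_gt])

theorem rearrangement_add_le {f g : α → E} {c : ℝ≥0∞} (hf : ∀ x, ‖f x‖ₑ ≤ c) (s : ℝ) :
    rearrangement μ (f + g) s ≤ c + rearrangement μ g s := by
  refine rearrangement_le_of_measure_le
    ((measure_mono fun x hx => ?_).trans (measure_rearrangement_lt_le g s))
  have hx' : c + rearrangement μ g s < ‖f x + g x‖ₑ := hx
  change rearrangement μ g s < ‖g x‖ₑ
  by_contra h
  exact hx'.not_ge ((enorm_add_le _ _).trans (add_le_add (hf x) (not_lt.1 h)))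

/-- Chebyshev's inequality for the decreasing rearrangement. -/
theorem rearrangement_le_lintegral_div {f : α → E} (hf : AEStronglyMeasurable f μ) {r s : ℝ}
    (hr : 0 < r) (hs : 0 < s) :
    rearrangement μ f s ≤ ((∫⁻ x, ‖f x‖ₑ ^ r ∂μ) / ENNReal.ofReal s) ^ r⁻¹ := by
  set I := ∫⁻ x, ‖f x‖ₑ ^ r ∂μ with hI
  have hs0 : ENNReal.ofReal s ≠ 0 := by simpa using hs
  have hm : AEMeasurable (fun x => ‖f x‖ₑ ^ r) μ := hf.enorm.pow_const r
  refine rearrangement_le_of_measure_le ?_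
  rcases eq_or_ne I 0 with h0 | h0
  · have : μ {x | (I / ENNReal.ofReal s) ^ r⁻¹ < ‖f x‖ₑ} = 0 := by
      rw [h0, ENNReal.zero_div, ENNReal.zero_rpow_of_pos (inv_pos.2 hr)]
      have h1 := (lintegral_eq_zero_iff' hm).1 h0
      refine measure_mono_null (fun x hx => ?_) h1
      simp only [mem_compl_iff, mem_ofPred_eq, Pi.zero_apply, ENNReal.rpow_eq_zero_iff]
      have : ‖f x‖ₑ ≠ 0 := (ne_of_gt hx)
      simp [this, hr.not_gt]
    simp [this]
  rcases eq_or_ne I ⊤ with h1 | h1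
  · simp [h1, ENNReal.top_div, ENNReal.top_rpow_of_pos (inv_pos.2 hr)]
  calc μ {x | (I / ENNReal.ofReal s) ^ r⁻¹ < ‖f x‖ₑ}
      ≤ μ {x | I / ENNReal.ofReal s ≤ ‖f x‖ₑ ^ r} :=
        measure_mono fun x hx => ((ENNReal.rpow_inv_lt_iff hr).1 hx).le
    _ ≤ I / (I / ENNReal.ofReal s) :=
        meas_ge_le_lintegral_div hm (ENNReal.div_ne_zero.2 ⟨h0, ofReal_ne_top⟩)
          (ENNReal.div_ne_top h1 hs0)
    _ = ENNReal.ofReal s := by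
        rw [ENNReal.div_eq_inv_mul, ENNReal.inv_div (Or.inl ofReal_ne_top) (Or.inl hs0),
          ENNReal.div_mul_cancel h0 h1]

theorem volume_setOf_ofReal_lt (m : ℝ≥0∞) :
    volume.restrict (Ioi (0 : ℝ)) {s | ENNReal.ofReal s < m} = m := by
  have hmeas : MeasurableSet {s : ℝ | ENNReal.ofReal s < m} :=
    measurableSet_lt ENNReal.measurable_ofReal measurable_const
  rw [Measure.restrict_apply hmeas]
  rcases eq_or_ne m ⊤ with h | h
  · simp [h]
  · have : {s : ℝ | ENNReal.ofReal s < m} ∩ Ioi 0 = Ioo 0 m.toReal := by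
      ext s
      simp only [mem_inter_iff, mem_ofPred_eq, mem_Ioi, mem_Ioo]
      constructor
      · rintro ⟨h1, h2⟩
        exact ⟨h2, (ENNReal.ofReal_lt_iff_lt_toReal h2.le h).1 h1⟩
      · rintro ⟨h1, h2⟩
        exact ⟨(ENNReal.ofReal_lt_iff_lt_toReal h1.le h).2 h2, h1⟩
    rw [this, Real.volume_Ioo, sub_zero, ENNReal.ofReal_toReal h]

/-- A function and its decreasing rearrangement have the same `L^r` norm. -/
theorem lintegral_rearrangement_rpow {f : α → E} (hf : AEStronglyMeasurable f μ) {r : ℝ}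
    (hr : 0 < r) (hfin : ∀ s, 0 < s → rearrangement μ f s ≠ ⊤) :
    ∫⁻ s in Ioi (0 : ℝ), rearrangement μ f s ^ r = ∫⁻ x, ‖f x‖ₑ ^ r ∂μ := by
  have h1 : ∫⁻ x, ‖f x‖ₑ ^ r ∂μ = ∫⁻ x, ENNReal.ofReal (‖f x‖ ^ r) ∂μ := by
    refine lintegral_congr fun x => ?_
    rw [← ofReal_norm, ENNReal.ofReal_rpow_of_nonneg (norm_nonneg _) hr.le]
  have h2 : ∫⁻ s in Ioi (0 : ℝ), rearrangement μ f s ^ r =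
      ∫⁻ s in Ioi (0 : ℝ), ENNReal.ofReal ((rearrangement μ f s).toReal ^ r) := by
    refine setLIntegral_congr_fun measurableSet_Ioi fun s hs => ?_
    rw [← ENNReal.ofReal_rpow_of_nonneg toReal_nonneg hr.le, ENNReal.ofReal_toReal (hfin s hs)]
  have hmeas : Measurable (rearrangement μ f) := (rearrangement_antitone f).measurable
  rw [h1, h2, lintegral_rpow_eq_lintegral_meas_lt_mul μ
      (Eventually.of_forall fun x => norm_nonneg _) hf.norm.aemeasurable hr,
    lintegral_rpow_eq_lintegral_meas_lt_mul _
      (Eventually.of_forall fun x => toReal_nonneg) hmeas.ennreal_toReal.aemeasurable hr]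
  congr 1
  refine setLIntegral_congr_fun measurableSet_Ioi fun t ht => ?_
  congr 1
  have h3 : μ {a | t < ‖f a‖} = μ {a | ENNReal.ofReal t < ‖f a‖ₑ} := by
    congr 1
    ext a
    simp only [mem_ofPred_eq]
    rw [← ofReal_norm, ENNReal.ofReal_lt_ofReal_iff_of_nonneg (le_of_lt ht)]
  rw [h3, ← volume_setOf_ofReal_lt (μ {a | ENNReal.ofReal t < ‖f a‖ₑ})]
  refine measure_congr ?_
  filter_upwards [ae_restrict_mem measurableSet_Ioi] with s hs
  refine propext ?_
  change t < (rearrangement μ f s).toReal ↔ _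
  rw [← ENNReal.ofReal_lt_iff_lt_toReal (le_of_lt ht) (hfin s hs), lt_rearrangement_iff]
  rfl

end Rearrangement

/-- The part of `f` of modulus greater than `c`. -/
noncomputable def highPart {α : Type*} (c : ℝ≥0∞) (f : α → ℂ) : α → ℂ :=
  fun x => {z : ℂ | c < ‖z‖ₑ}.indicator id (f x)

/-- The part of `f` of modulus at most `c`. -/
noncomputable def lowPart {α : Type*} (c : ℝ≥0∞) (f : α → ℂ) : α → ℂ :=
  fun x => {z : ℂ | c < ‖z‖ₑ}ᶜ.indicator id (f x)

section Truncation

variable {α : Type*} [MeasurableSpace α] {μ : Measure α} {f : α → ℂ}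

theorem highPart_add_lowPart {α : Type*} (c : ℝ≥0∞) (f : α → ℂ) :
    highPart c f + lowPart c f = f :=
  funext fun x => Set.indicator_self_add_compl_apply _ id (f x)

theorem measurableSet_setOf_lt_enorm (c : ℝ≥0∞) : MeasurableSet {z : ℂ | c < ‖z‖ₑ} :=
  measurableSet_lt measurable_const measurable_enorm

theorem enorm_highPart_le {α : Type*} (c : ℝ≥0∞) (f : α → ℂ) (x : α) :
    ‖highPart c f x‖ₑ ≤ ‖f x‖ₑ :=
  enorm_indicator_le_enorm_self id (f x)

theorem enorm_lowPart_le {α : Type*} (c : ℝ≥0∞) (f : α → ℂ) (x : α) :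
    ‖lowPart c f x‖ₑ ≤ ‖f x‖ₑ :=
  enorm_indicator_le_enorm_self id (f x)

theorem enorm_lowPart_le_const {α : Type*} (c : ℝ≥0∞) (f : α → ℂ) (x : α) :
    ‖lowPart c f x‖ₑ ≤ c := by
  by_cases h : c < ‖f x‖ₑ
  · simp [lowPart, h]
  · simp only [lowPart, indicator, mem_compl_iff, mem_ofPred_eq, h, not_false_eq_true, if_true, id]
    exact not_lt.1 h

theorem integrable_highPart (c : ℝ≥0∞) (hf : Integrable f μ) : Integrable (highPart c f) μ :=
  hf.mono_enorm
    ((measurable_id.indicator (measurableSet_setOf_lt_enorm c)).comp_aemeasurable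
      hf.1.aemeasurable).aestronglyMeasurable
    (Eventually.of_forall (enorm_highPart_le c f))

theorem integrable_lowPart (c : ℝ≥0∞) (hf : Integrable f μ) : Integrable (lowPart c f) μ :=
  hf.mono_enorm
    ((measurable_id.indicator (measurableSet_setOf_lt_enorm c).compl).comp_aemeasurable
      hf.1.aemeasurable).aestronglyMeasurable
    (Eventually.of_forall (enorm_lowPart_le c f))

theorem memLp_two_lowPart {c : ℝ≥0∞} (hc : c ≠ ⊤) (hf : Integrable f μ) :
    MemLp (lowPart c f) 2 μ := by
  have hi := integrable_lowPart c hf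
  refine ⟨hi.1, (eLpNorm_lt_top_iff_lintegral_rpow_enorm_lt_top two_ne_zero ofNat_ne_top).2 ?_⟩
  calc ∫⁻ x, ‖lowPart c f x‖ₑ ^ (2 : ℝ≥0∞).toReal ∂μ
      ≤ ∫⁻ x, c * ‖lowPart c f x‖ₑ ∂μ := by
        refine lintegral_mono fun x => ?_
        rw [toReal_ofNat, ENNReal.rpow_ofNat, sq]
        gcongr
        exact enorm_lowPart_le_const c f x
    _ < ⊤ := by
        rw [lintegral_const_mul' _ _ hc]
        exact ENNReal.mul_lt_top (lt_top_iff_ne_top.2 hc) hi.2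

theorem rearrangement_ne_top_of_integrable (hf : Integrable f μ) {s : ℝ} (hs : 0 < s) :
    rearrangement μ f s ≠ ⊤ := by
  refine ne_top_of_le_ne_top ?_ (rearrangement_le_lintegral_div hf.1 one_pos hs)
  simp only [ENNReal.rpow_one, inv_one]
  exact ENNReal.div_ne_top hf.2.ne (by simpa using hs)

theorem lintegral_highPart_le (hf : Integrable f μ) (u : ℝ) :
    ∫⁻ x, ‖highPart (rearrangement μ f u) f x‖ₑ ∂μ ≤
      ∫⁻ s in Ioo (0 : ℝ) u, rearrangement μ f s := by
  set c := rearrangement μ f u with hc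
  have hi := integrable_highPart c hf
  have h := lintegral_rearrangement_rpow hi.1 one_pos
    (fun s hs => rearrangement_ne_top_of_integrable hi hs)
  simp only [ENNReal.rpow_one] at h
  rw [← h, ← lintegral_indicator measurableSet_Ioi, ← lintegral_indicator measurableSet_Ioo]
  refine lintegral_mono fun s => ?_
  by_cases hs : 0 < s
  swap
  · simp [hs]
  by_cases hu : s < u
  · simp only [indicator, mem_Ioi, hs, mem_Ioo, hu, and_self, if_true]
    exact rearrangement_mono (enorm_highPart_le c f) s
  · simp only [indicator, mem_Ioi, hs, mem_Ioo, hu, and_false, if_true, if_false, nonpos_iff_eq_zero]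
    refine le_antisymm (rearrangement_le_of_measure_le ?_) zero_le
    refine (measure_mono fun x hx => ?_).trans ((measure_rearrangement_lt_le f u).trans
      (ENNReal.ofReal_le_ofReal (not_lt.1 hu)))
    by_contra h
    have h' : ¬ c < ‖f x‖ₑ := h
    simp [highPart, h'] at hx

theorem lintegral_lowPart_sq_le (hf : Integrable f μ) {u : ℝ} (hu : 0 < u) :
    ∫⁻ x, ‖lowPart (rearrangement μ f u) f x‖ₑ ^ (2 : ℝ) ∂μ ≤
      2 * ∫⁻ s in Ioi (u / 2), rearrangement μ f s ^ (2 : ℝ) := by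
  set c := rearrangement μ f u with hc
  have hi := integrable_lowPart c hf
  rw [← lintegral_rearrangement_rpow hi.1 two_pos
    (fun s hs => rearrangement_ne_top_of_integrable hi hs)]
  have hsplit : Ioi (0 : ℝ) = Ioc 0 (u / 2) ∪ Ioi (u / 2) :=
    (Ioc_union_Ioi_eq_Ioi (by positivity)).symm
  have hlow : ∫⁻ s in Ioc 0 (u / 2), rearrangement μ (lowPart c f) s ^ (2 : ℝ) ≤
      ∫⁻ s in Ioi (u / 2), rearrangement μ f s ^ (2 : ℝ) := by
    calc ∫⁻ s in Ioc 0 (u / 2), rearrangement μ (lowPart c f) s ^ (2 : ℝ)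
        ≤ ∫⁻ s in Ioc 0 (u / 2), c ^ (2 : ℝ) := by
          refine lintegral_mono fun s => ?_
          gcongr
          exact rearrangement_le_of_enorm_le (enorm_lowPart_le_const c f) s
      _ = ∫⁻ s in Ioc (u / 2) u, c ^ (2 : ℝ) := by
          simp only [setLIntegral_const, Real.volume_Ioc]
          congr 2
          ring
      _ ≤ ∫⁻ s in Ioc (u / 2) u, rearrangement μ f s ^ (2 : ℝ) := by
          refine setLIntegral_mono' measurableSet_Ioc fun s hs => ?_
          gcongr
          exact rearrangement_antitone f hs.2
      _ ≤ ∫⁻ s in Ioi (u / 2), rearrangement μ f s ^ (2 : ℝ) :=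
          lintegral_mono_set Ioc_subset_Ioi_self
  rw [hsplit, two_mul]
  refine (lintegral_union_le _ _ _).trans (add_le_add hlow ?_)
  refine lintegral_mono fun s => ?_
  gcongr
  exact rearrangement_mono (enorm_lowPart_le c f) s

end Truncation

theorem lintegral_Ioo_rpow {a u : ℝ} (ha : 0 < a) (hu : 0 < u) :
    ∫⁻ v in Ioo 0 u, ENNReal.ofReal (v ^ (a - 1)) = ENNReal.ofReal (u ^ a / a) := by
  have h_int : IntegrableOn (fun v : ℝ => v ^ (a - 1)) (Ioc 0 u) :=
    (intervalIntegrable_iff_integrableOn_Ioc_of_le hu.le).1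
      (intervalIntegral.intervalIntegrable_rpow' (by linarith))
  rw [setLIntegral_congr Ioo_ae_eq_Ioc, ← ofReal_integral_eq_lintegral_ofReal h_int
    ((ae_restrict_mem measurableSet_Ioc).mono fun v hv => Real.rpow_nonneg hv.1.le _),
    ← intervalIntegral.integral_of_le hu.le, integral_rpow (Or.inl (by linarith))]
  simp [Real.zero_rpow ha.ne']

theorem lintegral_Ioi_rpow {b u : ℝ} (hb : 0 < b) (hu : 0 < u) :
    ∫⁻ v in Ioi u, ENNReal.ofReal (v ^ (-b - 1)) = ENNReal.ofReal (u ^ (-b) / b) := by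
  rw [← ofReal_integral_eq_lintegral_ofReal (integrableOn_Ioi_rpow_of_lt (by linarith) hu)
    ((ae_restrict_mem measurableSet_Ioi).mono fun v hv => Real.rpow_nonneg (hu.trans hv).le _),
    integral_Ioi_rpow_of_lt (by linarith) hu]
  congr 1
  rw [sub_add_cancel, neg_div_neg_eq]

theorem lintegral_mul_setLIntegral_swap {S : Set (ℝ × ℝ)} (hS : MeasurableSet S)
    {w Φ : ℝ → ℝ≥0∞} (hw : Measurable w) (hΦ : Measurable Φ) :
    ∫⁻ s in Ioi 0, w s * ∫⁻ v in {v | (s, v) ∈ S} ∩ Ioi 0, Φ v =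
      ∫⁻ v in Ioi 0, Φ v * ∫⁻ s in {s | (s, v) ∈ S} ∩ Ioi 0, w s := by
  have hS1 : ∀ s, MeasurableSet {v | (s, v) ∈ S} := fun s => measurable_prodMk_left hS
  have hS2 : ∀ v, MeasurableSet {s | (s, v) ∈ S} := fun v => measurable_prodMk_right hS
  calc ∫⁻ s in Ioi 0, w s * ∫⁻ v in {v | (s, v) ∈ S} ∩ Ioi 0, Φ v
      = ∫⁻ s in Ioi 0, ∫⁻ v in Ioi 0, S.indicator (fun q => w q.1 * Φ q.2) (s, v) := by
        refine lintegral_congr fun s => ?_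
        rw [← lintegral_const_mul _ hΦ, ← Measure.restrict_restrict (hS1 s),
          ← lintegral_indicator (hS1 s)]
        rfl
    _ = ∫⁻ v in Ioi 0, ∫⁻ s in Ioi 0, S.indicator (fun q => w q.1 * Φ q.2) (s, v) := by
        refine lintegral_lintegral_swap (Measurable.aemeasurable ?_)
        exact ((hw.comp measurable_fst).mul (hΦ.comp measurable_snd)).indicator hS
    _ = _ := by
        refine lintegral_congr fun v => ?_
        rw [← lintegral_const_mul _ hw, ← Measure.restrict_restrict (hS2 v),
          ← lintegral_indicator (hS2 v)]
        refine lintegral_congr fun s => ?_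
        simp only [indicator, mem_ofPred_eq, mul_comm]

theorem lintegral_Ioo_sq_le {F : ℝ → ℝ≥0∞} (hF : Measurable F) {a u : ℝ} (ha : 0 < a)
    (hu : 0 < u) :
    (∫⁻ v in Ioo 0 u, F v) ^ (2 : ℝ) ≤
      ENNReal.ofReal (u ^ a / a) *
        ∫⁻ v in Ioo 0 u, ENNReal.ofReal (v ^ (1 - a)) * F v ^ (2 : ℝ) := by
  have hsq : ∀ v ∈ Ioo 0 u, ∀ b : ℝ,
      ENNReal.ofReal (v ^ (b / 2)) ^ (2 : ℝ) = ENNReal.ofReal (v ^ b) := fun v hv b => by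
    rw [ENNReal.ofReal_rpow_of_nonneg (Real.rpow_nonneg hv.1.le _) zero_le_two,
      ← Real.rpow_mul hv.1.le, div_mul_cancel₀ _ two_ne_zero]
  have hholder := ENNReal.lintegral_mul_le_Lp_mul_Lq (volume.restrict (Ioo 0 u))
    (p := 2) (q := 2) (f := fun v => ENNReal.ofReal (v ^ ((a - 1) / 2)))
    (g := fun v => ENNReal.ofReal (v ^ ((1 - a) / 2)) * F v)
    (by constructor <;> norm_num) (by fun_prop) (by fun_prop)
  have h1 : ∫⁻ v in Ioo 0 u, ENNReal.ofReal (v ^ ((a - 1) / 2)) ^ (2 : ℝ) =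
      ENNReal.ofReal (u ^ a / a) := by
    rw [← lintegral_Ioo_rpow ha hu]
    exact setLIntegral_congr_fun measurableSet_Ioo fun v hv => hsq v hv _
  have h2 : ∫⁻ v in Ioo 0 u, (ENNReal.ofReal (v ^ ((1 - a) / 2)) * F v) ^ (2 : ℝ) =
      ∫⁻ v in Ioo 0 u, ENNReal.ofReal (v ^ (1 - a)) * F v ^ (2 : ℝ) := by
    refine setLIntegral_congr_fun measurableSet_Ioo fun v hv => ?_
    rw [ENNReal.mul_rpow_of_nonneg _ _ zero_le_two, hsq v hv]
  have h3 : ∫⁻ v in Ioo 0 u, F v = ∫⁻ v in Ioo 0 u,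
      ((fun v => ENNReal.ofReal (v ^ ((a - 1) / 2))) *
        (fun v => ENNReal.ofReal (v ^ ((1 - a) / 2)) * F v)) v := by
    refine setLIntegral_congr_fun measurableSet_Ioo fun v hv => ?_
    simp only [Pi.mul_apply]
    rw [← mul_assoc, ← ENNReal.ofReal_mul (Real.rpow_nonneg hv.1.le _), ← Real.rpow_add hv.1]
    ring_nf
    simp
  rw [h1, h2, ← h3] at hholder
  calc (∫⁻ v in Ioo 0 u, F v) ^ (2 : ℝ) ≤ _ := ENNReal.rpow_le_rpow hholder zero_le_two
    _ = _ := by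
      rw [ENNReal.mul_rpow_of_nonneg _ _ zero_le_two, ← ENNReal.rpow_mul, ← ENNReal.rpow_mul]
      simp

/-- Hardy's inequality for the averages of `F` near the origin, in inverted variables. -/
theorem lintegral_hardy_low {F : ℝ → ℝ≥0∞} (hF : Measurable F) {a c : ℝ} (ha : 0 < a)
    (hc : 0 < c) :
    ∫⁻ s in Ioi 0, ENNReal.ofReal (s ^ (2 * a - 1)) * (∫⁻ v in Ioo 0 (c / s), F v) ^ (2 : ℝ) ≤
      ENNReal.ofReal (c ^ (2 * a) / a ^ 2) *
        ∫⁻ v in Ioi 0, ENNReal.ofReal (v ^ (1 - 2 * a)) * F v ^ (2 : ℝ) := by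
  have hS : MeasurableSet {q : ℝ × ℝ | q.1 * q.2 < c} :=
    measurableSet_lt (by fun_prop) measurable_const
  have hset1 : ∀ s : ℝ, 0 < s →
      Ioo 0 (c / s) = {v | (s, v) ∈ {q : ℝ × ℝ | q.1 * q.2 < c}} ∩ Ioi 0 :=
    fun s hs => by
      ext v
      simp only [mem_Ioo, mem_inter_iff, mem_ofPred_eq, mem_Ioi, lt_div_iff₀ hs, mul_comm s]
      tauto
  have hset2 : ∀ v : ℝ, 0 < v → {s | (s, v) ∈ {q : ℝ × ℝ | q.1 * q.2 < c}} ∩ Ioi 0 =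
      Ioo 0 (c / v) :=
    fun v hv => by
      ext s
      simp only [mem_Ioo, mem_inter_iff, mem_ofPred_eq, mem_Ioi, lt_div_iff₀ hv]
      tauto
  set Φ : ℝ → ℝ≥0∞ := fun v => ENNReal.ofReal (v ^ (1 - a)) * F v ^ (2 : ℝ) with hΦ
  have hΦm : Measurable Φ := by fun_prop
  calc ∫⁻ s in Ioi 0, ENNReal.ofReal (s ^ (2 * a - 1)) * (∫⁻ v in Ioo 0 (c / s), F v) ^ (2 : ℝ)
      ≤ ∫⁻ s in Ioi 0, ENNReal.ofReal (c ^ a / a) * (ENNReal.ofReal (s ^ (a - 1)) *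
          ∫⁻ v in {v | (s, v) ∈ {q : ℝ × ℝ | q.1 * q.2 < c}} ∩ Ioi 0, Φ v) := by
        refine setLIntegral_mono' measurableSet_Ioi fun s hs => ?_
        have hs' : 0 < s := hs
        rw [← hset1 s hs]
        refine (mul_le_mul_right (lintegral_Ioo_sq_le hF ha (div_pos hc hs)) _).trans
          (le_of_eq ?_)
        rw [← mul_assoc, ← mul_assoc, ← ENNReal.ofReal_mul (Real.rpow_nonneg hs'.le _),
          ← ENNReal.ofReal_mul (by positivity)]
        congr 2
        rw [Real.div_rpow hc.le hs'.le, show 2 * a - 1 = (a - 1) + a by ring, Real.rpow_add hs']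
        have := (Real.rpow_pos_of_pos hs' a).ne'
        field_simp
    _ = ENNReal.ofReal (c ^ a / a) * ∫⁻ v in Ioi 0, Φ v *
          ∫⁻ s in {s | (s, v) ∈ {q : ℝ × ℝ | q.1 * q.2 < c}} ∩ Ioi 0,
            ENNReal.ofReal (s ^ (a - 1)) := by
        rw [lintegral_const_mul' _ _ ofReal_ne_top,
          lintegral_mul_setLIntegral_swap hS (by fun_prop) hΦm]
    _ = ENNReal.ofReal (c ^ a / a) * ∫⁻ v in Ioi 0, ENNReal.ofReal (c ^ a / a) *
          (ENNReal.ofReal (v ^ (1 - 2 * a)) * F v ^ (2 : ℝ)) := by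
        congr 1
        refine setLIntegral_congr_fun measurableSet_Ioi fun v hv => ?_
        have hv' : 0 < v := hv
        simp only [hset2 v hv, lintegral_Ioo_rpow ha (div_pos hc hv), hΦ]
        rw [mul_right_comm, ← mul_assoc, ← ENNReal.ofReal_mul (Real.rpow_nonneg hv'.le _),
          ← ENNReal.ofReal_mul (by positivity)]
        congr 2
        rw [Real.div_rpow hc.le hv'.le, show 1 - a = (1 - 2 * a) + a by ring, Real.rpow_add hv']
        have := (Real.rpow_pos_of_pos hv' a).ne'
        field_simp
    _ = _ := by
        rw [lintegral_const_mul' _ _ ofReal_ne_top, ← mul_assoc,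
          ← ENNReal.ofReal_mul (by positivity)]
        congr 2
        rw [two_mul, Real.rpow_add hc]
        field_simp

/-- Hardy's inequality for the tails of `F`, in inverted variables. -/
theorem lintegral_hardy_high {F : ℝ → ℝ≥0∞} (hF : Measurable F) {a c : ℝ} (ha : a < 1 / 2)
    (hc : 0 < c) :
    ∫⁻ s in Ioi 0, ENNReal.ofReal (s ^ (2 * a - 1)) *
        ((∫⁻ v in Ioi (c / s), F v ^ (2 : ℝ)) / ENNReal.ofReal s) =
      ENNReal.ofReal (c ^ (2 * a - 1) / (1 - 2 * a)) *
        ∫⁻ v in Ioi 0, ENNReal.ofReal (v ^ (1 - 2 * a)) * F v ^ (2 : ℝ) := by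
  have hS : MeasurableSet {q : ℝ × ℝ | c < q.1 * q.2} :=
    measurableSet_lt measurable_const (by fun_prop)
  have hset1 : ∀ s : ℝ, 0 < s →
      Ioi (c / s) = {v | (s, v) ∈ {q : ℝ × ℝ | c < q.1 * q.2}} ∩ Ioi 0 :=
    fun s hs => by
      ext v
      simp only [mem_inter_iff, mem_ofPred_eq, mem_Ioi, div_lt_iff₀ hs, mul_comm s]
      exact ⟨fun h => ⟨h, pos_of_mul_pos_left (hc.trans h) hs.le⟩, fun h => h.1⟩
  have hset2 : ∀ v : ℝ, 0 < v → {s | (s, v) ∈ {q : ℝ × ℝ | c < q.1 * q.2}} ∩ Ioi 0 =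
      Ioi (c / v) :=
    fun v hv => by
      ext s
      simp only [mem_inter_iff, mem_ofPred_eq, mem_Ioi, div_lt_iff₀ hv]
      exact ⟨fun h => h.1, fun h => ⟨h, pos_of_mul_pos_left (hc.trans h) hv.le⟩⟩
  calc ∫⁻ s in Ioi 0, ENNReal.ofReal (s ^ (2 * a - 1)) *
        ((∫⁻ v in Ioi (c / s), F v ^ (2 : ℝ)) / ENNReal.ofReal s)
      = ∫⁻ s in Ioi 0, ENNReal.ofReal (s ^ (-(1 - 2 * a) - 1)) *
          ∫⁻ v in {v | (s, v) ∈ {q : ℝ × ℝ | c < q.1 * q.2}} ∩ Ioi 0, F v ^ (2 : ℝ) := by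
        refine setLIntegral_congr_fun measurableSet_Ioi fun s hs => ?_
        have hs' : 0 < s := hs
        simp only [← hset1 s hs]
        rw [div_eq_mul_inv, mul_comm (∫⁻ v in Ioi (c / s), F v ^ (2 : ℝ)), ← mul_assoc,
          ← ENNReal.ofReal_inv_of_pos hs', ← ENNReal.ofReal_mul (Real.rpow_nonneg hs'.le _),
          ← Real.rpow_neg_one, ← Real.rpow_add hs']
        ring_nf
    _ = ∫⁻ v in Ioi 0, F v ^ (2 : ℝ) *
          ∫⁻ s in {s | (s, v) ∈ {q : ℝ × ℝ | c < q.1 * q.2}} ∩ Ioi 0,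
            ENNReal.ofReal (s ^ (-(1 - 2 * a) - 1)) :=
        lintegral_mul_setLIntegral_swap hS (by fun_prop) (by fun_prop)
    _ = ∫⁻ v in Ioi 0, ENNReal.ofReal (c ^ (2 * a - 1) / (1 - 2 * a)) *
          (ENNReal.ofReal (v ^ (1 - 2 * a)) * F v ^ (2 : ℝ)) := by
        refine setLIntegral_congr_fun measurableSet_Ioi fun v hv => ?_
        have hv' : 0 < v := hv
        have hb : 0 < 1 - 2 * a := by linarith
        simp only [hset2 v hv, lintegral_Ioi_rpow hb (div_pos hc hv)]
        rw [mul_comm, ← mul_assoc, ← ENNReal.ofReal_mul (by positivity)]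
        congr 2
        rw [Real.div_rpow hc.le hv'.le, Real.rpow_neg hv'.le, neg_sub]
        field_simp
    _ = _ := lintegral_const_mul' _ _ ofReal_ne_top

theorem lornorm_eq (n : ℕ) {p : ℝ} (hp : 0 < p) (f : Rn n → ℂ) :
    lornorm n p f = (∫⁻ s in Ioi (0 : ℝ), ENNReal.ofReal (s ^ (2 * p⁻¹ - 1)) *
      rearrangement volume f s ^ (2 : ℝ)) ^ (2 : ℝ)⁻¹ := by
  rw [lornorm, lorentzNorm, if_neg ofNat_ne_top, toReal_ofNat, ENNReal.toReal_ofReal hp.le]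
  congr 1
  refine setLIntegral_congr_fun measurableSet_Ioi fun s hs => ?_
  have hs' : 0 < s := hs
  rw [ENNReal.mul_rpow_of_nonneg _ _ zero_le_two, mul_right_comm,
    ENNReal.ofReal_rpow_of_nonneg (Real.rpow_nonneg hs'.le _) zero_le_two,
    ← ENNReal.ofReal_mul (by positivity), ← Real.rpow_mul hs'.le, ← Real.rpow_neg_one s,
    ← Real.rpow_add hs', mul_comm p⁻¹, ← sub_eq_add_neg]

theorem lornorm_zero (n : ℕ) {p : ℝ} (hp : 0 < p) : lornorm n p (0 : Rn n → ℂ) = 0 := by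
  have h : ∀ s, rearrangement volume (0 : Rn n → ℂ) s = 0 := fun s =>
    le_antisymm (rearrangement_le_of_enorm_le (by simp) s) zero_le
  simp [lornorm_eq n hp, h]

theorem lornorm_two_schrodinger_le {n : ℕ} {t : ℝ} (ht : t ≠ 0) {f : Rn n → ℂ}
    (hf : Integrable f) : lornorm n 2 (schrodinger n t f) ≤ lornorm n 2 f := by
  have hfin : ∀ s : ℝ, 0 < s → rearrangement volume (schrodinger n t f) s ≠ ⊤ := fun s _ =>
    ne_top_of_le_ne_top (ENNReal.mul_ne_top ofReal_ne_top hf.2.ne)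
      (rearrangement_le_of_enorm_le (enorm_schrodinger_le ht f) s)
  have hl : ∀ g : Rn n → ℂ, AEStronglyMeasurable g →
      (∀ s : ℝ, 0 < s → rearrangement volume g s ≠ ⊤) →
      lornorm n 2 g = (∫⁻ x, ‖g x‖ₑ ^ (2 : ℝ)) ^ (2 : ℝ)⁻¹ := fun g hg hgf => by
    rw [lornorm_eq n two_pos, ← lintegral_rearrangement_rpow hg two_pos hgf]
    simp
  rw [hl _ (continuous_schrodinger ht hf).aestronglyMeasurable hfin,
    hl f hf.1 fun s hs => rearrangement_ne_top_of_integrable hf hs]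
  refine ENNReal.rpow_le_rpow ?_ (by norm_num)
  rcases eq_or_ne (∫⁻ x, ‖f x‖ₑ ^ (2 : ℝ)) ⊤ with h | h
  · rw [h]
    exact le_top
  · refine (lintegral_schrodinger_sq ht hf ⟨hf.1, ?_⟩).le
    rw [eLpNorm_lt_top_iff_lintegral_rpow_enorm_lt_top two_ne_zero ofNat_ne_top]
    exact lt_top_iff_ne_top.2 (by simpa using h)

/-- The decreasing rearrangement of `S(t) f` is controlled by splitting `f` at the level `f*(u)`. -/
theorem rearrangement_schrodinger_le {n : ℕ} {t : ℝ} (ht : t ≠ 0) {f : Rn n → ℂ}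
    (hf : Integrable f) {s u : ℝ} (hs : 0 < s) (hu : 0 < u) :
    rearrangement volume (schrodinger n t f) s ≤
      ENNReal.ofReal (kernelBound n t) * (∫⁻ v in Ioo 0 u, rearrangement volume f v) +
        (2 * ((∫⁻ v in Ioi (u / 2), rearrangement volume f v ^ (2 : ℝ)) /
          ENNReal.ofReal s)) ^ (2 : ℝ)⁻¹ := by
  set c := rearrangement volume f u with hc
  have hctop : c ≠ ⊤ := rearrangement_ne_top_of_integrable hf hu
  have hhigh := integrable_highPart c hf
  have hlow := integrable_lowPart c hf
  have hsum : schrodinger n t f =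
      schrodinger n t (highPart c f) + schrodinger n t (lowPart c f) := by
    rw [← schrodinger_add hhigh hlow, highPart_add_lowPart]
  rw [hsum]
  refine (rearrangement_add_le (enorm_schrodinger_le ht _) s).trans ?_
  gcongr
  · exact lintegral_highPart_le hf u
  · refine (rearrangement_le_lintegral_div
      (continuous_schrodinger ht hlow).aestronglyMeasurable two_pos hs).trans ?_
    rw [lintegral_schrodinger_sq ht hlow (memLp_two_lowPart hctop hf), ← mul_div_assoc]
    gcongr
    exact lintegral_lowPart_sq_le hf hu

theorem lintegral_rearrangement_schrodinger_le {n : ℕ} {t : ℝ} (ht : t ≠ 0) {f : Rn n → ℂ}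
    (hf : Integrable f) {a : ℝ} (ha : 0 < a) (ha' : a < 1 / 2) :
    ∫⁻ s in Ioi (0 : ℝ), ENNReal.ofReal (s ^ (2 * a - 1)) *
        rearrangement volume (schrodinger n t f) s ^ (2 : ℝ) ≤
      ENNReal.ofReal (2 / a ^ 2 + 4 * 2 ^ (1 - 2 * a) / (1 - 2 * a)) *
        ENNReal.ofReal (kernelBound n t ^ (2 * (1 - 2 * a))) *
        ∫⁻ v in Ioi 0, ENNReal.ofReal (v ^ (1 - 2 * a)) * rearrangement volume f v ^ (2 : ℝ) := by
  set M := kernelBound n t with hM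
  have hMpos : 0 < M := kernelBound_pos n ht
  set F := rearrangement volume f with hF
  have hFm : Measurable F := (rearrangement_antitone f).measurable
  set N := ∫⁻ v in Ioi 0, ENNReal.ofReal (v ^ (1 - 2 * a)) * F v ^ (2 : ℝ) with hN
  set c : ℝ := M ^ (-2 : ℝ) with hc
  have hcpos : 0 < c := Real.rpow_pos_of_pos hMpos _
  have hb : 0 < 1 - 2 * a := by linarith
  have hpt : ∀ s : ℝ, 0 < s →
      rearrangement volume (schrodinger n t f) s ^ (2 : ℝ) ≤
        2 * ENNReal.ofReal (M ^ (2 : ℝ)) * (∫⁻ v in Ioo 0 (c / s), F v) ^ (2 : ℝ) +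
        4 * ((∫⁻ v in Ioi ((c / 2) / s), F v ^ (2 : ℝ)) / ENNReal.ofReal s) := fun s hs => by
    have h1 := rearrangement_schrodinger_le ht hf hs (div_pos hcpos hs)
    refine (ENNReal.rpow_le_rpow h1 zero_le_two).trans
      ((ENNReal.rpow_add_le_mul_rpow_add_rpow _ _ one_le_two).trans (le_of_eq ?_))
    rw [ENNReal.mul_rpow_of_nonneg _ _ zero_le_two, ← ENNReal.rpow_mul,
      ENNReal.ofReal_rpow_of_nonneg hMpos.le zero_le_two, div_right_comm c 2 s]
    norm_num
    ring
  have hm1 : Measurable fun s : ℝ => ENNReal.ofReal (s ^ (2 * a - 1)) *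
      (∫⁻ v in Ioo 0 (c / s), F v) ^ (2 : ℝ) := by
    have hmono : Monotone fun u : ℝ => ∫⁻ v in Ioo 0 u, F v := fun _ _ h =>
      lintegral_mono_set (Ioo_subset_Ioo_right h)
    exact (by fun_prop : Measurable fun s : ℝ => ENNReal.ofReal (s ^ (2 * a - 1))).mul
      ((hmono.measurable.comp (by fun_prop : Measurable fun s : ℝ => c / s)).pow_const _)
  calc ∫⁻ s in Ioi (0 : ℝ), ENNReal.ofReal (s ^ (2 * a - 1)) *
        rearrangement volume (schrodinger n t f) s ^ (2 : ℝ)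
      ≤ ∫⁻ s in Ioi (0 : ℝ), (2 * ENNReal.ofReal (M ^ (2 : ℝ)) *
          (ENNReal.ofReal (s ^ (2 * a - 1)) * (∫⁻ v in Ioo 0 (c / s), F v) ^ (2 : ℝ)) +
          4 * (ENNReal.ofReal (s ^ (2 * a - 1)) *
            ((∫⁻ v in Ioi ((c / 2) / s), F v ^ (2 : ℝ)) / ENNReal.ofReal s))) := by
        refine setLIntegral_mono' measurableSet_Ioi fun s hs => ?_
        refine (mul_le_mul_right (hpt s hs) _).trans (le_of_eq ?_)
        ring
    _ ≤ 2 * ENNReal.ofReal (M ^ (2 : ℝ)) * (ENNReal.ofReal (c ^ (2 * a) / a ^ 2) * N) +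
          4 * (ENNReal.ofReal ((c / 2) ^ (2 * a - 1) / (1 - 2 * a)) * N) := by
        rw [lintegral_add_left (hm1.const_mul _), lintegral_const_mul' _ _ (by finiteness),
          lintegral_const_mul' _ _ (by finiteness), lintegral_hardy_high hFm ha' (half_pos hcpos)]
        gcongr
        exact lintegral_hardy_low hFm ha hcpos
    _ = _ := by
        have e1 : M ^ (2 : ℝ) * c ^ (2 * a) = M ^ (2 * (1 - 2 * a)) := by
          rw [hc, ← Real.rpow_mul hMpos.le, ← Real.rpow_add hMpos]
          ring_nf
        have e2 : (c / 2) ^ (2 * a - 1) = M ^ (2 * (1 - 2 * a)) * 2 ^ (1 - 2 * a) := by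
          rw [Real.div_rpow hcpos.le zero_le_two, hc, ← Real.rpow_mul hMpos.le, div_eq_mul_inv,
            ← Real.rpow_neg zero_le_two]
          ring_nf
        have h2 : (2 : ℝ≥0∞) = ENNReal.ofReal 2 := by simp
        have h4 : (4 : ℝ≥0∞) = ENNReal.ofReal 4 := by simp
        rw [← mul_assoc, ← mul_assoc, ← add_mul, h2, h4, ← ENNReal.ofReal_mul zero_le_two,
          ← ENNReal.ofReal_mul (by positivity), ← ENNReal.ofReal_mul (by positivity),
          ← ENNReal.ofReal_add (by positivity) (by positivity),
          ← ENNReal.ofReal_mul (by positivity), e2, ← e1]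
        congr 2
        ring

theorem kernelBound_rpow_le (n : ℕ) {t a : ℝ} (ht : t ≠ 0) (ha : a ≤ 1 / 2) :
    kernelBound n t ^ (1 - 2 * a) ≤ |t| ^ (-((n : ℝ) * (1 / 2 - a))) := by
  have h4 : 1 ≤ 4 * Real.pi := by linarith [Real.pi_gt_three]
  rw [kernelBound, ← Real.rpow_mul (by positivity),
    show -(n : ℝ) / 2 * (1 - 2 * a) = -((n : ℝ) * (1 / 2 - a)) by ring,
    Real.mul_rpow (by positivity) (abs_nonneg t)]
  refine mul_le_of_le_one_left (Real.rpow_nonneg (abs_nonneg t) _) ?_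
  refine Real.rpow_le_one_of_one_le_of_nonpos h4 (neg_nonpos.2 ?_)
  exact mul_nonneg n.cast_nonneg (by linarith)

/-- time decay of `e^{itΔ}` in Lorentz spaces:
`‖S(t)f‖_{L^{p,2}} ≲ |t|^{-n(1/2-1/p)} ‖f‖_{L^{p',2}}` for `2 ≤ p < ∞`. -/
theorem schrodinger_decay_lorentz (n : ℕ) (hn : 1 ≤ n) (p : ℝ) (hp : 2 ≤ p) :
    ∃ C : ℝ≥0∞, C < ∞ ∧ ∀ t : ℝ, t ≠ 0 → ∀ f : Rn n → ℂ,
      lornorm n p (schrodinger n t f) ≤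
        C * ENNReal.ofReal (|t| ^ (-((n:ℝ) * (1/2 - 1/p)))) * lornorm n (p / (p - 1)) f := by
  have hp0 : 0 < p := by linarith
  rcases hp.eq_or_lt with rfl | hp2
  · refine ⟨1, one_lt_top, fun t ht f => ?_⟩
    by_cases hf : Integrable f
    · have h := lornorm_two_schrodinger_le ht hf
      norm_num
      exact h
    · rw [schrodinger_of_not_integrable hf, lornorm_zero n two_pos]
      exact zero_le
  have ha : 0 < p⁻¹ := inv_pos.2 hp0
  have ha' : p⁻¹ < 1 / 2 := by
    rw [one_div]
    exact inv_strictAnti₀ two_pos hp2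
  refine ⟨ENNReal.ofReal (2 / p⁻¹ ^ 2 + 4 * 2 ^ (1 - 2 * p⁻¹) / (1 - 2 * p⁻¹)) ^ (2 : ℝ)⁻¹,
    by finiteness, fun t ht f => ?_⟩
  by_cases hf : Integrable f
  swap
  · rw [schrodinger_of_not_integrable hf, lornorm_zero n hp0]
    exact zero_le
  have hq : 0 < p / (p - 1) := div_pos hp0 (by linarith)
  have hconj : 2 * (p / (p - 1))⁻¹ - 1 = 1 - 2 * p⁻¹ := by
    field_simp
    ring
  rw [lornorm_eq n hp0, lornorm_eq n hq, hconj]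
  refine (ENNReal.rpow_le_rpow (lintegral_rearrangement_schrodinger_le ht hf ha ha')
    (by norm_num)).trans ?_
  rw [ENNReal.mul_rpow_of_nonneg _ _ (by norm_num), ENNReal.mul_rpow_of_nonneg _ _ (by norm_num)]
  gcongr
  have hM := kernelBound_pos n ht
  rw [ENNReal.ofReal_rpow_of_nonneg (Real.rpow_nonneg hM.le _) (by norm_num),
    ← Real.rpow_mul hM.le, show 2 * (1 - 2 * p⁻¹) * (2 : ℝ)⁻¹ = 1 - 2 * p⁻¹ by ring, one_div p]
  exact ENNReal.ofReal_le_ofReal (kernelBound_rpow_le n ht ha'.le)
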